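/- arXiv:2512.23492 — 4 statements merged into one kernel-verified Lean document; each statement's English description precedes it below -/
import Mathlib

section
/- Let G be a circle graph and let x be a good vertex of G. Then there exists a chord diagram D representing G in which the neighborhood N_G(x) is consecutive in D. -/
open List

variable {α : Type*}

/-- Two elements `x` and `y` alternate in the cyclic word `D`: their occurrences
appear in cyclic order `x, y, x, y`. -/
def Alternate (D : List α) (x y : α) : Prop :=
  ∃ A B C E : List α, D ~r ([x] ++ A ++ [y] ++ B ++ [x] ++ C ++ [y] ++ E)

/-- `D` is a chord diagram on the vertex type `α`: every element occurs exactly twice. -/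
def IsChordDiagram [DecidableEq α] (D : List α) : Prop :=
  ∀ v : α, D.count v = 2

/-- The cyclic word `D` represents the simple graph `G`: two distinct vertices are
adjacent iff they alternate in `D`. -/
def Represents (D : List α) (G : SimpleGraph α) : Prop :=
  ∀ x y : α, x ≠ y → (G.Adj x y ↔ Alternate D x y)

/-- `G` is a circle graph: some chord diagram represents it. -/
def IsCircleGraph [DecidableEq α] (G : SimpleGraph α) : Prop :=
  ∃ D : List α, IsChordDiagram D ∧ Represents D G

/-- The set `S` is consecutive in the cyclic word `D`: some rotation of `D` begins
with a factor containing exactly one occurrence of every element of `S` and no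
occurrence of any element outside of `S`. -/
def Consecutive [DecidableEq α] (D : List α) (S : Set α) : Prop :=
  ∃ F R : List α, D ~r (F ++ R) ∧ (∀ v ∈ F, v ∈ S) ∧ ∀ s ∈ S, F.count s = 1

/-- `σ` is a LexBFS ordering of the vertices in `W`. -/
def IsLexBFSOrderOn (G : SimpleGraph α) (W : Set α) (σ : List α) : Prop :=
  σ.Nodup ∧ (∀ v : α, v ∈ σ ↔ v ∈ W) ∧
    ∀ i j k : Fin σ.length, i < j → j < k →
      G.Adj (σ.get i) (σ.get k) → ¬ G.Adj (σ.get i) (σ.get j) →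
      ∃ h : Fin σ.length, h < i ∧ G.Adj (σ.get h) (σ.get j) ∧ ¬ G.Adj (σ.get h) (σ.get k)

/-- `σ` is a LexBFS ordering of (all the vertices of) `G`. -/
def IsLexBFSOrder (G : SimpleGraph α) (σ : List α) : Prop :=
  IsLexBFSOrderOn G Set.univ σ

/-- A vertex is good if some LexBFS ordering of `G` ends at it. -/
def GoodVertex (G : SimpleGraph α) (x : α) : Prop :=
  ∃ σ : List α, IsLexBFSOrder G σ ∧ σ.getLast? = some x

namespace CircleGraph

theorem isRotated_iff_exists_append {D D' : List α} :
    D ~r D' ↔ ∃ A B : List α, D = A ++ B ∧ D' = B ++ A := by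
  constructor
  · rintro ⟨n, rfl⟩
    refine ⟨D.take (n % D.length), D.drop (n % D.length), (take_append_drop _ _).symm, ?_⟩
    rw [← rotate_mod]
    rcases Nat.eq_zero_or_pos D.length with h | h
    · simp [List.length_eq_zero_iff.mp h]
    · exact rotate_eq_drop_append_take (Nat.mod_lt _ h).le
  · rintro ⟨A, B, rfl, rfl⟩
    exact isRotated_append

theorem isRotated_filter {D D' : List α} (h : D ~r D') (p : α → Bool) :
    D.filter p ~r D'.filter p := by
  obtain ⟨A, B, rfl, rfl⟩ := isRotated_iff_exists_append.mp h
  simpa using isRotated_append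

theorem isRotated_xyxy {L : List α} {x y : α} :
    L ~r [x, y, x, y] ↔ L = [x, y, x, y] ∨ L = [y, x, y, x] := by
  rw [← mem_cyclicPermutations_iff]
  simp [cyclicPermutations]
  tauto

theorem alternate_congr {D D' : List α} (h : D ~r D') {x y : α} :
    Alternate D x y ↔ Alternate D' x y := by
  constructor
  · rintro ⟨A, B, C, E, hD⟩
    exact ⟨A, B, C, E, h.symm.trans hD⟩
  · rintro ⟨A, B, C, E, hD⟩
    exact ⟨A, B, C, E, h.trans hD⟩

/-- The LexBFS condition for the ordering of `W` by increasing values of `f`. -/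
def IsLexBFSOn (G : SimpleGraph α) (W : Finset α) (f : α → ℕ) : Prop :=
  ∀ a ∈ W, ∀ b ∈ W, ∀ c ∈ W, f a < f b → f b < f c → G.Adj a c → ¬ G.Adj a b →
    ∃ h ∈ W, f h < f a ∧ G.Adj h b ∧ ¬ G.Adj h c

/-- If every neighbour of `b` preceding `b` is a neighbour of the last vertex `x`, then all
vertices from `b` on have the same neighbours preceding `b`. -/
theorem IsLexBFSOn.adj_iff_adj_last {G : SimpleGraph α} {W : Finset α} {f : α → ℕ} {x b : α}
    (hf : IsLexBFSOn G W f) (hinj : Set.InjOn f W) (hx : x ∈ W) (hlast : ∀ y ∈ W, f y ≤ f x)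
    (hb : b ∈ W) (hbx : ∀ p ∈ W, f p < f b → G.Adj p b → G.Adj p x) :
    ∀ p ∈ W, f p < f b → ∀ c ∈ W, f b ≤ f c → (G.Adj p c ↔ G.Adj p x) := by
  have lt_last : ∀ c ∈ W, c ≠ x → f c < f x := fun c hc hcx =>
    lt_of_le_of_ne (hlast c hc) fun e => hcx (hinj hc hx e)
  have hbx' : ∀ p ∈ W, f p < f b → (G.Adj p b ↔ G.Adj p x) := by
    intro p hp hpb
    refine ⟨hbx p hp hpb, fun hpx => ?_⟩
    by_contra hn
    have hne : b ≠ x := by rintro rfl; exact hn hpx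
    obtain ⟨h, hh, hlt, h1, h2⟩ := hf p hp b hb x hx hpb (lt_last b hb hne) hpx hn
    exact h2 (hbx h hh (hlt.trans hpb) h1)
  suffices H : ∀ n, ∀ p ∈ W, f p = n → f p < f b → ∀ c ∈ W, f b ≤ f c →
      (G.Adj p c ↔ G.Adj p x) from fun p hp => H _ p hp rfl
  intro n
  induction n using Nat.strong_induction_on with
  | _ n ih =>
    rintro p hp rfl hpb c hc hbc
    constructor
    · intro hpc
      by_contra hn
      have hnb : ¬ G.Adj p b := fun e => hn ((hbx' p hp hpb).mp e)
      have hlt : f b < f c := lt_of_le_of_ne hbc fun e => hnb (hinj hb hc e ▸ hpc)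
      obtain ⟨h, hh, h1, h2, h3⟩ := hf p hp b hb c hc hpb hlt hpc hnb
      exact h3 ((ih _ h1 h hh rfl (h1.trans hpb) c hc hbc).mpr
        ((hbx' h hh (h1.trans hpb)).mp h2))
    · intro hpx
      by_contra hn
      have hne : c ≠ x := by rintro rfl; exact hn hpx
      obtain ⟨h, hh, h1, h2, h3⟩ :=
        hf p hp c hc x hx (hpb.trans_le hbc) (lt_last c hc hne) hpx hn
      exact h3 ((ih _ h1 h hh rfl (h1.trans hpb) c hc hbc).mp h2)

variable [DecidableEq α]

/-- The restriction of a word to the two letters `x` and `y`. -/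
def restrictPair (D : List α) (x y : α) : List α :=
  D.filter fun v => v = x ∨ v = y

theorem restrictPair_append (D D' : List α) (x y : α) :
    restrictPair (D ++ D') x y = restrictPair D x y ++ restrictPair D' x y := by
  simp [restrictPair]

theorem restrictPair_of_notMem_right {A : List α} {x y : α} (h : y ∉ A) :
    restrictPair A x y = replicate (A.count x) x := by
  rw [← filter_eq]
  refine filter_congr fun v hv => ?_
  have : v ≠ y := fun e => h (e ▸ hv)
  simp [this]

theorem restrictPair_of_notMem_left {A : List α} {x y : α} (h : x ∉ A) :
    restrictPair A x y = replicate (A.count y) y := by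
  rw [← filter_eq]
  refine filter_congr fun v hv => ?_
  have : v ≠ x := fun e => h (e ▸ hv)
  simp [this]

theorem alternate_iff_restrictPair {D : List α} {x y : α} (hxy : x ≠ y)
    (hx : D.count x = 2) (hy : D.count y = 2) :
    Alternate D x y ↔ restrictPair D x y ~r [x, y, x, y] := by
  constructor
  · rintro ⟨A, B, C, E, h⟩
    have h1 := h.perm.count_eq x
    have h2 := h.perm.count_eq y
    simp [hx, hy, hxy, hxy.symm] at h1 h2
    have key : ∀ L : List α, L.count x = 0 → L.count y = 0 →
        L.filter (fun v => v = x ∨ v = y) = [] := by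
      intro L hLx hLy
      rw [List.count_eq_zero] at hLx hLy
      rw [filter_eq_nil_iff]
      intro a ha
      have : a ≠ x := fun e => hLx (e ▸ ha)
      have : a ≠ y := fun e => hLy (e ▸ ha)
      simp [*]
    have h3 := isRotated_filter h (fun v => v = x ∨ v = y)
    simp only [filter_append] at h3
    rw [key A (by omega) (by omega), key B (by omega) (by omega),
      key C (by omega) (by omega), key E (by omega) (by omega)] at h3
    simpa [restrictPair] using h3
  · intro h
    have key : ∀ a b : α, restrictPair D x y = [a, b, a, b] →
        ∃ A B C E Z : List α,
          D = Z ++ a :: (A ++ b :: (B ++ a :: (C ++ b :: E))) := by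
      intro a b hab
      obtain ⟨Z, T, rfl, -, -, hT⟩ := filter_eq_cons_iff.mp hab
      obtain ⟨A, T, rfl, -, -, hT⟩ := filter_eq_cons_iff.mp hT
      obtain ⟨B, T, rfl, -, -, hT⟩ := filter_eq_cons_iff.mp hT
      obtain ⟨C, T, rfl, -, -, hT⟩ := filter_eq_cons_iff.mp hT
      exact ⟨A, B, C, T, Z, rfl⟩
    rcases isRotated_xyxy.mp h with h | h
    · obtain ⟨A, B, C, E, Z, rfl⟩ := key _ _ h
      exact ⟨A, B, C, E ++ Z, isRotated_iff_exists_append.mpr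
        ⟨Z, x :: (A ++ y :: (B ++ x :: (C ++ y :: E))), by simp, by simp⟩⟩
    · obtain ⟨A, B, C, E, Z, rfl⟩ := key _ _ h
      exact ⟨B, C, E ++ Z, A, isRotated_iff_exists_append.mpr
        ⟨Z ++ y :: A, x :: (B ++ y :: (C ++ x :: E)), by simp, by simp⟩⟩

theorem alternate_interleave {A₁ B₁ A₂ B₂ : List α} {s p : α} (hsp : s ≠ p)
    (hs : A₁.count s + A₂.count s = 2) (hp : B₁.count p + B₂.count p = 2)
    (hs₁ : s ∉ B₁) (hs₂ : s ∉ B₂) (hp₁ : p ∉ A₁) (hp₂ : p ∉ A₂) :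
    Alternate (A₁ ++ B₁ ++ A₂ ++ B₂) s p ↔ A₁.count s = 1 ∧ B₁.count p = 1 := by
  have e := List.count_eq_zero.mpr hs₁
  have e' := List.count_eq_zero.mpr hs₂
  have e'' := List.count_eq_zero.mpr hp₁
  have e''' := List.count_eq_zero.mpr hp₂
  rw [alternate_iff_restrictPair hsp (by simp [count_append]; omega)
    (by simp [count_append]; omega), isRotated_xyxy, restrictPair_append, restrictPair_append,
    restrictPair_append, restrictPair_of_notMem_right hp₁, restrictPair_of_notMem_right hp₂,
    restrictPair_of_notMem_left hs₁, restrictPair_of_notMem_left hs₂]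
  generalize A₁.count s = a at *
  generalize A₂.count s = a' at *
  generalize B₁.count p = b at *
  generalize B₂.count p = b' at *
  have ha : a ≤ 2 := by omega
  have hb : b ≤ 2 := by omega
  obtain rfl : a' = 2 - a := by omega
  obtain rfl : b' = 2 - b := by omega
  interval_cases a <;> interval_cases b <;> simp [replicate_succ, hsp, hsp.symm]

/-- `D` is a chord diagram on `W` representing the subgraph of `G` induced by `W`. -/
structure IsDiagramOn (G : SimpleGraph α) (W : Finset α) (D : List α) : Prop where
  count_eq_two : ∀ v ∈ W, D.count v = 2
  mem : ∀ v ∈ D, v ∈ W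
  adj_iff : ∀ y ∈ W, ∀ z ∈ W, y ≠ z → (G.Adj y z ↔ Alternate D y z)

namespace IsDiagramOn

variable {G : SimpleGraph α} {W : Finset α} {D : List α}

theorem rotate (h : IsDiagramOn G W D) {D' : List α} (hr : D ~r D') : IsDiagramOn G W D' where
  count_eq_two v hv := by rw [← hr.perm.count_eq, h.count_eq_two v hv]
  mem v hv := h.mem v (hr.mem_iff.mpr hv)
  adj_iff y hy z hz hyz := (h.adj_iff y hy z hz hyz).trans (alternate_congr hr)

theorem filter (h : IsDiagramOn G W D) {W' : Finset α} (hW : W' ⊆ W) :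
    IsDiagramOn G W' (D.filter (· ∈ W')) where
  count_eq_two v hv := by rw [count_filter (by simpa using hv), h.count_eq_two v (hW hv)]
  mem v hv := by simpa using (mem_filter.mp hv).2
  adj_iff y hy z hz hyz := by
    rw [h.adj_iff y (hW hy) z (hW hz) hyz,
      alternate_iff_restrictPair hyz (h.count_eq_two y (hW hy)) (h.count_eq_two z (hW hz)),
      alternate_iff_restrictPair hyz
        (by rw [count_filter (by simpa using hy), h.count_eq_two y (hW hy)])
        (by rw [count_filter (by simpa using hz), h.count_eq_two z (hW hz)])]
    have : restrictPair (D.filter (· ∈ W')) y z = restrictPair D y z := by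
      unfold restrictPair
      rw [filter_filter]
      refine filter_congr fun v _ => ?_
      by_cases h1 : v = y
      · simp [h1, hy]
      · by_cases h2 : v = z
        · simp [h2, hz]
        · simp [h1, h2]
    rw [this]

theorem notMem_of_cons {a : α} {A B : List α} (h : IsDiagramOn G W (a :: A ++ a :: B)) :
    a ∉ A ∧ a ∉ B := by
  have := h.count_eq_two a (h.mem a (by simp))
  simp at this
  exact ⟨List.count_eq_zero.mp (by omega), List.count_eq_zero.mp (by omega)⟩

theorem count_add_count {a : α} {A B : List α} (h : IsDiagramOn G W (a :: A ++ a :: B))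
    {y : α} (hy : y ∈ W) (hya : y ≠ a) : A.count y + B.count y = 2 := by
  have := h.count_eq_two y hy
  simpa [count_cons, hya.symm] using this

theorem adj_iff_count {a : α} {A B : List α} (h : IsDiagramOn G W (a :: A ++ a :: B))
    {y : α} (hy : y ∈ W) (hya : y ≠ a) : G.Adj a y ↔ A.count y = 1 := by
  rw [h.adj_iff a (h.mem a (by simp)) y hy hya.symm]
  have := alternate_interleave (A₁ := [a]) (B₁ := A) (A₂ := [a]) (B₂ := B) hya.symm
    (by simp) (h.count_add_count hy hya) h.notMem_of_cons.1 h.notMem_of_cons.2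
    (by simpa using hya) (by simpa using hya)
  simpa using this

theorem erase {a : α} {A B : List α} (h : IsDiagramOn G W (a :: A ++ a :: B)) :
    IsDiagramOn G (W.erase a) (A ++ B) := by
  have h' := h.filter (W.erase_subset a)
  have key : ∀ L : List α, (∀ v ∈ L, v ∈ W) → a ∉ L → L.filter (· ∈ W.erase a) = L := by
    intro L hL ha
    rw [filter_eq_self]
    intro v hv
    have : v ≠ a := fun e => ha (e ▸ hv)
    simp [this, hL v hv]
  have e : (a :: A ++ a :: B).filter (· ∈ W.erase a) = A ++ B := by
    rw [filter_append, filter_cons_of_neg (by simp), filter_cons_of_neg (by simp),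
      key A (fun v hv => h.mem v (by simp [hv])) h.notMem_of_cons.1,
      key B (fun v hv => h.mem v (by simp [hv])) h.notMem_of_cons.2]
  rwa [e] at h'

theorem exists_rotate_cons (h : IsDiagramOn G W D) {a : α} (ha : a ∈ W) :
    ∃ A B : List α, IsDiagramOn G W (a :: A ++ a :: B) := by
  have hc := h.count_eq_two a ha
  obtain ⟨Z, T, rfl⟩ := append_of_mem (count_pos_iff.mp (by omega : 0 < D.count a))
  have hr : Z ++ a :: T ~r a :: T ++ Z := isRotated_append
  have hm : a ∈ T ++ Z := by
    rw [← count_pos_iff]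
    simp only [count_append, count_cons_self] at hc ⊢
    omega
  obtain ⟨A, B, hAB⟩ := append_of_mem hm
  refine ⟨A, B, ?_⟩
  have := h.rotate hr
  rwa [cons_append, hAB, ← cons_append] at this

/-- Interleaving a diagram on `S` with a diagram on `P`. -/
theorem interleave {S P : Finset α} {A₁ B₁ A₂ B₂ : List α} (hd : Disjoint S P)
    (hA : IsDiagramOn G S (A₁ ++ A₂)) (hB : IsDiagramOn G P (B₁ ++ B₂))
    (hadj : ∀ s ∈ S, ∀ p ∈ P, G.Adj s p ↔ A₁.count s = 1 ∧ B₁.count p = 1) :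
    IsDiagramOn G (S ∪ P) (A₁ ++ B₁ ++ A₂ ++ B₂) := by
  have nB : ∀ s ∈ S, s ∉ B₁ ++ B₂ := fun s hs h =>
    Finset.disjoint_left.mp hd hs (hB.mem s h)
  have nA : ∀ p ∈ P, p ∉ A₁ ++ A₂ := fun p hp h =>
    Finset.disjoint_left.mp hd (hA.mem p h) hp
  have cnt : ∀ v ∈ S ∪ P, (A₁ ++ B₁ ++ A₂ ++ B₂).count v = 2 := by
    intro v hv
    rcases Finset.mem_union.mp hv with hv | hv
    · have h1 := hA.count_eq_two v hv
      have h2 := List.count_eq_zero.mpr (nB v hv)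
      simp only [count_append] at h1 h2 ⊢
      omega
    · have h1 := hB.count_eq_two v hv
      have h2 := List.count_eq_zero.mpr (nA v hv)
      simp only [count_append] at h1 h2 ⊢
      omega
  have cross : ∀ s ∈ S, ∀ p ∈ P, G.Adj s p ↔ Alternate (A₁ ++ B₁ ++ A₂ ++ B₂) s p := by
    intro s hs p hp
    have h1 := nB s hs
    have h2 := nA p hp
    rw [mem_append, not_or] at h1 h2
    rw [hadj s hs p hp, alternate_interleave
      (by rintro rfl; exact Finset.disjoint_left.mp hd hs hp)
      (by rw [← count_append, hA.count_eq_two s hs])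
      (by rw [← count_append, hB.count_eq_two p hp]) h1.1 h1.2 h2.1 h2.2]
  refine ⟨cnt, ?_, ?_⟩
  · intro v hv
    simp only [mem_append] at hv
    rw [Finset.mem_union]
    rcases hv with ((hv | hv) | hv) | hv
    · exact Or.inl (hA.mem v (by simp [hv]))
    · exact Or.inr (hB.mem v (by simp [hv]))
    · exact Or.inl (hA.mem v (by simp [hv]))
    · exact Or.inr (hB.mem v (by simp [hv]))
  · have nil : ∀ (L : List α) (y z : α), y ∉ L → z ∉ L → restrictPair L y z = [] := by
      intro L y z hy hz
      rw [restrictPair_of_notMem_left hy, List.count_eq_zero.mpr hz, replicate_zero]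
    intro y hy z hz hyz
    rcases Finset.mem_union.mp hy with hy' | hy' <;> rcases Finset.mem_union.mp hz with hz' | hz'
    · have h1 := nB y hy'
      have h2 := nB z hz'
      rw [mem_append, not_or] at h1 h2
      rw [hA.adj_iff y hy' z hz' hyz, alternate_iff_restrictPair hyz (hA.count_eq_two y hy')
        (hA.count_eq_two z hz'), alternate_iff_restrictPair hyz (cnt y hy) (cnt z hz)]
      simp [restrictPair_append, nil B₁ y z h1.1 h2.1, nil B₂ y z h1.2 h2.2]
    · exact cross y hy' z hz'
    · rw [G.adj_comm, cross z hz' y hy',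
        alternate_iff_restrictPair hyz.symm (cnt z hz) (cnt y hy),
        alternate_iff_restrictPair hyz (cnt y hy) (cnt z hz)]
      have : ∀ L : List α, restrictPair L z y = restrictPair L y z := by
        intro L
        exact filter_congr fun v _ => by simp [or_comm]
      rw [this, isRotated_xyxy, isRotated_xyxy, or_comm]
    · have h1 := nA y hy'
      have h2 := nA z hz'
      rw [mem_append, not_or] at h1 h2
      rw [hB.adj_iff y hy' z hz' hyz, alternate_iff_restrictPair hyz (hB.count_eq_two y hy')
        (hB.count_eq_two z hz'), alternate_iff_restrictPair hyz (cnt y hy) (cnt z hz)]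
      simp [restrictPair_append, nil A₁ y z h1.1 h2.1, nil A₂ y z h1.2 h2.2]

/-- Two vertices on different sides of the chord `x` are not adjacent. -/
theorem not_adj_of_sides {x y z : α} {A B : List α} (h : IsDiagramOn G W (x :: A ++ x :: B))
    (hy : y ∈ W) (hz : z ∈ W) (hyx : y ≠ x) (hzx : z ≠ x) (hyA : y ∉ A) (hzB : z ∉ B) :
    ¬ G.Adj y z := by
  have hy2 := h.count_add_count hy hyx
  have hz2 := h.count_add_count hz hzx
  rw [List.count_eq_zero.mpr hyA] at hy2
  rw [List.count_eq_zero.mpr hzB] at hz2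
  have hyz : y ≠ z := by
    rintro rfl
    rw [List.count_eq_zero.mpr hzB] at hy2
    omega
  have hz' : (x :: A ++ [x]).count z = 2 := by
    simp [hzx.symm]; omega
  rw [G.adj_comm, h.adj_iff z hz y hy hyz.symm]
  have e : x :: A ++ x :: B = x :: A ++ [x] ++ B ++ [] ++ [] := by simp
  rw [e, alternate_interleave (A₁ := x :: A ++ [x]) (B₁ := B) (A₂ := []) (B₂ := [])
    (s := z) (p := y) hyz.symm (by simpa using hz') (by simpa using hy2) hzB (by simp)
    (by simp [hyA, hyx]) (by simp), hz']
  simp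

end IsDiagramOn

theorem exists_diagram_one_side (G : SimpleGraph α) (f : α → ℕ) (x : α) (n : ℕ) :
    ∀ W : Finset α, W.card = n → Set.InjOn f W → x ∈ W → (∀ y ∈ W, f y ≤ f x) →
      IsLexBFSOn G W f → (∃ D, IsDiagramOn G W D) →
      ∃ F R : List α, IsDiagramOn G W (x :: F ++ x :: R) ∧ ∀ v ∈ F, G.Adj x v := by
  induction n using Nat.strong_induction_on with
  | _ n ih =>
  rintro W rfl hinj hx hlast hf ⟨D, hD⟩
  have ih' : ∀ W' : Finset α, W' ⊂ W → x ∈ W' → IsLexBFSOn G W' f →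
      ∃ F R : List α, IsDiagramOn G W' (x :: F ++ x :: R) ∧ ∀ v ∈ F, G.Adj x v :=
    fun W' hW' hxW' hf' => ih _ (Finset.card_lt_card hW') W' rfl
      (hinj.mono (by exact_mod_cast hW'.subset)) hxW' (fun y hy => hlast y (hW'.subset hy)) hf'
      ⟨_, hD.filter hW'.subset⟩
  -- It suffices to split `W` before a vertex `b` that is not the first non-neighbour of `x`.
  have split : ∀ a ∈ W, ∀ b ∈ W, f a < f b → ¬ G.Adj x a → b ≠ x →
      (∀ p ∈ W, f p < f b → G.Adj p b → G.Adj p x) →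
      ∃ F R : List α, IsDiagramOn G W (x :: F ++ x :: R) ∧ ∀ v ∈ F, G.Adj x v := by
    intro a ha b hb hab hxa hbx hbP
    have huni := hf.adj_iff_adj_last hinj hx hlast hb hbP
    set S := W.filter fun v => f b ≤ f v with hS
    set P := W.filter fun v => f v < f b with hP
    have hxS : x ∈ S := by simp [hS, hx, hlast b hb]
    have hbS : b ∈ S := by simp [hS, hb]
    have haP : a ∈ P := by simp [hP, ha, hab]
    have hSP : Disjoint S P := by
      rw [Finset.disjoint_left]
      simp only [hS, hP, Finset.mem_filter]
      rintro v ⟨-, h1⟩ ⟨-, h2⟩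
      omega
    have hU : S ∪ P = W := by
      ext v
      simp only [hS, hP, Finset.mem_union, Finset.mem_filter]
      constructor
      · rintro (h | h) <;> exact h.1
      · intro h
        rcases le_or_gt (f b) (f v) with h' | h'
        · exact Or.inl ⟨h, h'⟩
        · exact Or.inr ⟨h, h'⟩
    have hSW : S ⊆ W := Finset.filter_subset _ _
    have hPW : P ⊆ W := Finset.filter_subset _ _
    have hadj : ∀ s ∈ S, ∀ p ∈ P, G.Adj s p ↔ G.Adj x p := by
      intro s hs p hp
      rw [G.adj_comm s, G.adj_comm x]
      exact huni p (hPW hp) (Finset.mem_filter.mp hp).2 s (hSW hs) (Finset.mem_filter.mp hs).2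
    have hxP : x ∉ P := Finset.disjoint_left.mp hSP hxS
    have hfS : IsLexBFSOn G S f := by
      intro i hi j hj k hk hij hjk hik hnij
      obtain ⟨h, hh, h1, h2, h3⟩ := hf i (hSW hi) j (hSW hj) k (hSW hk) hij hjk hik hnij
      rcases Finset.mem_union.mp (hU ▸ hh) with hh | hh
      · exact ⟨h, hh, h1, h2, h3⟩
      · exact absurd ((hadj k hk h hh).mpr ((hadj j hj h hh).mp h2.symm)).symm h3
    by_cases hu : ∃ u ∈ P, G.Adj x u
    · obtain ⟨u, huP, hxu⟩ := hu
      have huS : u ∉ S := Finset.disjoint_right.mp hSP huP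
      have hlt : ∀ p ∈ P, ∀ s ∈ S, f p < f s := fun p hp s hs =>
        (Finset.mem_filter.mp hp).2.trans_le (Finset.mem_filter.mp hs).2
      obtain ⟨F, R, hFR, hF⟩ := ih' (insert x P)
        (by
          rw [Finset.ssubset_iff_subset_ne]
          refine ⟨Finset.insert_subset hx hPW, fun e => ?_⟩
          have : b ∈ insert x P := e ▸ hb
          rcases Finset.mem_insert.mp this with h | h
          · exact hbx h
          · exact Finset.disjoint_left.mp hSP hbS h)
        (Finset.mem_insert_self _ _)
        (by
          intro i hi j hj k hk hij hjk hik hnij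
          have hsub : insert x P ⊆ W := Finset.insert_subset hx hPW
          obtain ⟨h, hh, h1, h2, h3⟩ :=
            hf i (hsub hi) j (hsub hj) k (hsub hk) hij hjk hik hnij
          refine ⟨h, ?_, h1, h2, h3⟩
          rcases Finset.mem_insert.mp hi with rfl | hi
          · exact absurd (hlast j (hsub hj)) (by omega)
          · exact Finset.mem_insert_of_mem (Finset.mem_filter.mpr
              ⟨hh, h1.trans (Finset.mem_filter.mp hi).2⟩))
      obtain ⟨F', R', hFR', hF'⟩ := ih' (insert u S)
        (by
          rw [Finset.ssubset_iff_subset_ne]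
          refine ⟨Finset.insert_subset (hPW huP) hSW, fun e => ?_⟩
          have : a ∈ insert u S := e ▸ ha
          rcases Finset.mem_insert.mp this with rfl | h
          · exact hxa hxu
          · exact Finset.disjoint_left.mp hSP h haP)
        (Finset.mem_insert_of_mem hxS)
        (by
          intro i hi j hj k hk hij hjk hik hnij
          rcases Finset.mem_insert.mp hi with rfl | hi
          · rcases Finset.mem_insert.mp hj with rfl | hj
            · omega
            · exact absurd ((hadj j hj _ huP).mpr hxu).symm hnij
          · have hj' : j ∈ S := by
              rcases Finset.mem_insert.mp hj with e | hj
              · exact absurd (hlt j (e ▸ huP) i hi) (by omega)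
              · exact hj
            have hk' : k ∈ S := by
              rcases Finset.mem_insert.mp hk with e | hk
              · exact absurd (hlt k (e ▸ huP) i hi) (by omega)
              · exact hk
            obtain ⟨h, hh, h'⟩ := hfS i hi j hj' k hk' hij hjk hik hnij
            exact ⟨h, Finset.mem_insert_of_mem hh, h'⟩)
      have hux : u ≠ x := hxu.ne'
      have hc1 := (hFR'.adj_iff_count (Finset.mem_insert_self u S) hux).mp hxu
      have hc2 := hFR'.count_add_count (Finset.mem_insert_self u S) hux
      obtain ⟨F₁, F₂, rfl⟩ := append_of_mem (count_pos_iff.mp (by omega : 0 < F'.count u))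
      obtain ⟨R₁, R₂, rfl⟩ := append_of_mem (count_pos_iff.mp (by omega : 0 < R'.count u))
      have hrot : IsDiagramOn G (insert u S)
          (u :: (R₂ ++ x :: F₁) ++ u :: (F₂ ++ x :: R₁)) :=
        hFR'.rotate (isRotated_iff_exists_append.mpr
          ⟨x :: (F₁ ++ u :: (F₂ ++ x :: R₁)), u :: R₂, by simp, by simp⟩)
      have hA := hrot.erase
      rw [Finset.erase_insert huS] at hA
      have hB := hFR.erase
      rw [Finset.erase_insert hxP] at hB
      have hI := IsDiagramOn.interleave hSP hA hB (by
        intro s hs p hp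
        have hsu : s ≠ u := fun e => huS (e ▸ hs)
        have hpx : p ≠ x := fun e => hxP (e ▸ hp)
        have h1 := (hrot.adj_iff_count (Finset.mem_insert_of_mem hs) hsu).mp
          ((hadj s hs u huP).mpr hxu).symm
        rw [hadj s hs p hp, hFR.adj_iff_count (Finset.mem_insert_of_mem hp) hpx]
        simp [h1])
      rw [hU] at hI
      refine ⟨F₁ ++ F ++ F₂, R₁ ++ R ++ R₂, hI.rotate (isRotated_iff_exists_append.mpr
        ⟨R₂, x :: (F₁ ++ F ++ F₂) ++ x :: (R₁ ++ R), by simp, by simp⟩), ?_⟩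
      intro v hv
      simp only [mem_append] at hv
      rcases hv with (hv | hv) | hv
      · exact hF' v (by simp [hv])
      · exact hF v hv
      · exact hF' v (by simp [hv])
    · obtain ⟨F, R, hFR, hF⟩ := ih' S
        (by
          rw [Finset.ssubset_iff_subset_ne]
          exact ⟨hSW, fun e => Finset.disjoint_right.mp hSP haP (e ▸ ha)⟩) hxS hfS
      have hI := IsDiagramOn.interleave (G := G) (A₁ := x :: F ++ x :: R) (A₂ := [])
        (B₁ := D.filter (· ∈ P)) (B₂ := []) hSP (by simpa using hFR)
        (by simpa using hD.filter hPW) (by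
          intro s hs p hp
          rw [hadj s hs p hp]
          have := hFR.count_eq_two s hs
          rw [this]
          simpa using fun h => hu ⟨p, hp, h⟩)
      rw [hU] at hI
      exact ⟨F, R ++ D.filter (· ∈ P), by simpa using hI, hF⟩
  obtain ⟨A, B, hAB⟩ := hD.exists_rotate_cons hx
  have hBA : IsDiagramOn G W (x :: B ++ x :: A) := hAB.rotate isRotated_append
  by_cases hA : ∀ v ∈ A, G.Adj x v
  · exact ⟨A, B, hAB, hA⟩
  by_cases hB : ∀ v ∈ B, G.Adj x v
  · exact ⟨B, A, hBA, hB⟩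
  -- Non-neighbours of `x` lie on both sides; the side containing the later first one gives `b`.
  have side : ∀ A B : List α, IsDiagramOn G W (x :: A ++ x :: B) →
      ∀ a ∈ A, ¬ G.Adj x a → ∀ b ∈ B, ¬ G.Adj x b → f a < f b →
      (∀ v ∈ B, ¬ G.Adj x v → f b ≤ f v) →
      ∃ F R : List α, IsDiagramOn G W (x :: F ++ x :: R) ∧ ∀ v ∈ F, G.Adj x v := by
    intro A B hAB a haA hxa b hbB hxb hab hmin
    have hbW : b ∈ W := hAB.mem b (by simp [hbB])
    have hbx : b ≠ x := fun e => hAB.notMem_of_cons.2 (e ▸ hbB)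
    refine split a (hAB.mem a (by simp [haA])) b hbW hab hxa hbx ?_
    intro p hp hpb hadj
    by_contra hn
    have hn' : ¬ G.Adj x p := fun e => hn e.symm
    have hpx : p ≠ x := by rintro rfl; exact hxb hadj
    have hpB : p ∉ B := fun h => absurd (hmin p h hn') (by omega)
    have hbA : b ∉ A := by
      have h1 := hAB.count_add_count hbW hbx
      have h2 := mt (hAB.adj_iff_count hbW hbx).mpr hxb
      have h3 := count_pos_iff.mpr hbB
      exact List.count_eq_zero.mp (by omega)
    exact hAB.not_adj_of_sides hbW hp hbx hpx hbA hpB hadj.symm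
  have first : ∀ L : List α, (¬ ∀ v ∈ L, G.Adj x v) →
      ∃ a ∈ L, ¬ G.Adj x a ∧ ∀ v ∈ L, ¬ G.Adj x v → f a ≤ f v := by
    classical
    intro L hL
    push Not at hL
    obtain ⟨v, hv, hxv⟩ := hL
    obtain ⟨a, ha, hmin⟩ := Finset.exists_min_image (L.toFinset.filter fun v => ¬ G.Adj x v) f
      ⟨v, by simp [hv, hxv]⟩
    simp only [Finset.mem_filter, mem_toFinset] at ha hmin
    exact ⟨a, ha.1, ha.2, fun v h1 h2 => hmin v ⟨h1, h2⟩⟩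
  obtain ⟨a, haA, hxa, hamin⟩ := first A hA
  obtain ⟨b, hbB, hxb, hbmin⟩ := first B hB
  rcases lt_trichotomy (f a) (f b) with h | h | h
  · exact side A B hAB a haA hxa b hbB hxb h hbmin
  · exfalso
    have haW := hAB.mem a (by simp [haA])
    have e : a = b := hinj haW (hAB.mem b (by simp [hbB])) h
    subst e
    have hax : a ≠ x := fun e => hAB.notMem_of_cons.1 (e ▸ haA)
    have h1 := hAB.count_add_count haW hax
    have h2 := mt (hAB.adj_iff_count haW hax).mpr hxa
    have h3 := count_pos_iff.mpr haA
    have h4 := count_pos_iff.mpr hbB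
    omega
  · exact side B A hBA b hbB hxb a haA hxa h hamin

end CircleGraph

/-- **Good vertex lemma.** If `G` is a circle graph and `x` is a good vertex of `G`,
then `G` has a chord diagram in which the neighbourhood of `x` is consecutive. -/
theorem good_vertex_consecutive_neighborhood {V : Type*} [Fintype V] [DecidableEq V]
    (G : SimpleGraph V) (hG : IsCircleGraph G) (x : V) (hx : GoodVertex G x) :
    ∃ D : List V, IsChordDiagram D ∧ Represents D G ∧
      Consecutive D (G.neighborSet x) := by
  obtain ⟨D, hD, hDG⟩ := hG
  obtain ⟨σ, ⟨hnd, hmem, hlex⟩, hlast⟩ := hx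
  have hmem' : ∀ v, v ∈ σ := fun v => (hmem v).mpr (Set.mem_univ v)
  have hlt : ∀ v, σ.idxOf v < σ.length := fun v => idxOf_lt_length_iff.mpr (hmem' v)
  have hinj : Function.Injective fun v => σ.idxOf v := fun v w h =>
    (idxOf_inj (hmem' v)).mp h
  have hlastx : ∀ v, σ.idxOf v ≤ σ.idxOf x := by
    intro v
    obtain ⟨τ, rfl⟩ := getLast?_eq_some_iff.mp hlast
    have hxτ : x ∉ τ := by
      intro h
      simpa [h] using (nodup_append.mp hnd).2.2 x h x
    have h1 := hlt v
    rw [idxOf_append_of_notMem hxτ]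
    simp at h1 ⊢
    omega
  have hf : CircleGraph.IsLexBFSOn G Finset.univ fun v => σ.idxOf v := by
    intro a _ b _ c _ hab hbc hac hnab
    obtain ⟨h, h1, h2, h3⟩ := hlex ⟨_, hlt a⟩ ⟨_, hlt b⟩ ⟨_, hlt c⟩ hab hbc
      (by simpa using hac) (by simpa using hnab)
    refine ⟨σ.get h, Finset.mem_univ _, ?_, by simpa using h2, by simpa using h3⟩
    have : σ.idxOf (σ.get h) = h := by simpa using hnd.idxOf_getElem h h.2
    exact this.trans_lt h1
  obtain ⟨F, R, hFR, hF⟩ := CircleGraph.exists_diagram_one_side G (fun v => σ.idxOf v) x _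
    Finset.univ rfl hinj.injOn (Finset.mem_univ x) (fun v _ => hlastx v) hf
    ⟨D, fun v _ => hD v, fun v _ => Finset.mem_univ v, fun y _ z _ h => hDG y z h⟩
  refine ⟨_, fun v => hFR.count_eq_two v (Finset.mem_univ v),
    fun y z h => hFR.adj_iff y (Finset.mem_univ y) z (Finset.mem_univ z) h,
    F, x :: R ++ [x], CircleGraph.isRotated_iff_exists_append.mpr
      ⟨[x], F ++ x :: R, by simp, by simp⟩, hF, ?_⟩
  intro s hs
  have hs' : G.Adj x s := hs
  exact (hFR.adj_iff_count (Finset.mem_univ s) hs'.ne').mp hs'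
end

section
/- Let D and D' be chord diagrams on disjoint finite sets V and V'. Let S be a subset of V with 1 < |S| < |V| that is consecutive in D with bookends x and y, and let S' be a subset of V' with 1 < |S'| < |V'| that is consecutive in D' with bookends x' and y'. Then the set X = (S \ {x}) ∪ (S' \ {x'}) is consecutive in at least one of the four chord diagrams (D,x)⊙(D',x'), (D',x')⊙(D,x), (D,x)⊙(D'^r,x'), (D'^r,x')⊙(D,x), where D'^r denotes the reversal of D'; moreover, in that diagram the bookends of X are y and y'. -/
open List

variable {α : Type*}

/-- `D` is a chord diagram on the set `W`: every element of `W` occurs exactly twice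
in `D`, and `D` contains no other letters. -/
def IsChordDiagramOn [DecidableEq α] (W : Set α) (D : List α) : Prop :=
  (∀ v ∈ W, D.count v = 2) ∧ ∀ v ∈ D, v ∈ W

/-- The set `S` is consecutive in the cyclic word `D`, via a factor whose first
letter is `x` and whose last letter is `y`. -/
def ConsecutiveWith [DecidableEq α] (D : List α) (S : Set α) (x y : α) : Prop :=
  ∃ F R : List α, D ~r (F ++ R) ∧ (∀ v ∈ F, v ∈ S) ∧ (∀ s ∈ S, F.count s = 1) ∧
    F.head? = some x ∧ F.getLast? = some y

/-- The set `S` is consecutive in the cyclic word `D` with (unordered) bookends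
`x` and `y`. -/
def ConsecutiveBookends [DecidableEq α] (D : List α) (S : Set α) (x y : α) : Prop :=
  ConsecutiveWith D S x y ∨ ConsecutiveWith D S y x

/-- The list `W` has a prefix that runs once through every letter of `T`, uses no other letter,
and ends in `y`. -/
def HasArcPrefix [DecidableEq α] (T : Set α) (y : α) (W : List α) : Prop :=
  ∃ G R : List α, W = G ++ R ∧ (∀ v ∈ G, v ∈ T) ∧ (∀ s ∈ T, G.count s = 1) ∧
    G.getLast? = some y

theorem append_cons_inj_of_notMem {x : α} {A B P Q : List α} (hA : x ∉ A) (hP : x ∉ P)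
    (h : A ++ x :: B = P ++ x :: Q) : A = P ∧ B = Q := by
  induction A generalizing P with
  | nil => cases P <;> simp_all
  | cons a A ih => cases P <;> grind

theorem eq_or_swap_of_isRotated {x : α} {A B P Q : List α}
    (hA : x ∉ A) (hP : x ∉ P) (hQ : x ∉ Q)
    (h : (x :: A ++ x :: B) ~r (x :: P ++ x :: Q)) :
    (A = P ∧ B = Q) ∨ (A = Q ∧ B = P) := by
  obtain ⟨n, hn, h⟩ := isRotated_iff_mod.1 h
  rw [rotate_eq_drop_append_take hn] at h
  have hab := take_append_drop n (x :: A ++ x :: B)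
  generalize take n (x :: A ++ x :: B) = a at h hab
  generalize drop n (x :: A ++ x :: B) = b at h hab
  rcases a with - | ⟨z, a⟩
  · left
    simp only [nil_append, append_nil] at h hab
    exact append_cons_inj_of_notMem hA hP (by simpa [hab] using h)
  rcases b with - | ⟨w, b⟩
  · left
    simp only [nil_append, append_nil] at h hab
    exact append_cons_inj_of_notMem hA hP (by simpa [hab] using h)
  simp only [cons_append, cons.injEq] at h hab
  obtain ⟨rfl, hab⟩ := hab
  obtain ⟨rfl, h⟩ := h
  classical
  have hc := congrArg (count w) h
  simp only [count_append, count_cons_self, count_eq_zero.2 hP, count_eq_zero.2 hQ] at hc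
  have hwa : w ∉ a := count_eq_zero.1 (by omega)
  have hwb : w ∉ b := count_eq_zero.1 (by omega)
  obtain ⟨rfl, rfl⟩ := append_cons_inj_of_notMem hA hwa hab.symm
  obtain ⟨rfl, rfl⟩ := append_cons_inj_of_notMem hwb hP h
  exact .inr ⟨rfl, rfl⟩

theorem ConsecutiveWith.reverse [DecidableEq α] {D : List α} {S : Set α} {x y : α}
    (h : ConsecutiveWith D S x y) : ConsecutiveWith D.reverse S y x := by
  obtain ⟨F, R, hD, hF, hc, hx, hy⟩ := h
  refine ⟨F.reverse, R.reverse, ?_, by simpa using hF, by simpa using hc, by simpa using hy,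
    by simpa using hx⟩
  exact hD.reverse.trans (by simpa using isRotated_append)

theorem ConsecutiveWith.hasArcPrefix [DecidableEq α] {D : List α} {S : Set α} {x y : α}
    (h : ConsecutiveWith D S x y) (hS : S.Nontrivial) (hxS : x ∈ S) (hx : D.count x = 2)
    {P Q : List α} (hPQ : D ~r (x :: P ++ x :: Q)) :
    HasArcPrefix (S \ {x}) y P ∨ HasArcPrefix (S \ {x}) y Q := by
  obtain ⟨F, R, hD, hF, hc, hhead, hlast⟩ := h
  obtain ⟨G, rfl⟩ : ∃ G, F = x :: G := by cases F <;> simp_all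
  obtain ⟨s, hsS, hsx⟩ := hS.exists_ne x
  have hxG : x ∉ G := by
    have := hc x hxS
    simpa [count_eq_zero] using this
  have hsG : s ∈ G := by
    have := hc s hsS
    have : s ∈ x :: G := count_pos_iff.1 (by omega)
    simpa [hsx] using this
  have hGc : ∀ t ∈ S \ {x}, G.count t = 1 := by
    rintro t ⟨htS, htx⟩
    have := hc t htS
    rwa [count_cons_of_ne (Ne.symm htx)] at this
  have hGS : ∀ v ∈ G, v ∈ S \ {x} := fun v hv =>
    ⟨hF v (mem_cons_of_mem _ hv), by rintro rfl; exact hxG hv⟩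
  have hGl : G.getLast? = some y := by
    cases G <;> simp_all [getLast?_cons_cons]
  have hR : x ∈ R := by
    have h1 := hD.perm.count_eq x
    rw [count_append, hc x hxS, hx] at h1
    exact count_pos_iff.1 (by omega)
  obtain ⟨A, B, rfl, hxA⟩ := eq_append_cons_of_mem hR
  have hcPQ := hPQ.perm.count_eq x
  simp only [count_append, count_cons_self, hx] at hcPQ
  have hP : x ∉ P := count_eq_zero.1 (by omega)
  have hQ : x ∉ Q := count_eq_zero.1 (by omega)
  have key : (x :: (G ++ A) ++ x :: B) ~r (x :: P ++ x :: Q) := by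
    simpa using hD.symm.trans hPQ
  rcases eq_or_swap_of_isRotated (by simp [hxG, hxA]) hP hQ key with ⟨h, -⟩ | ⟨h, -⟩
  · exact .inl ⟨G, A, h.symm, hGS, hGc, hGl⟩
  · exact .inr ⟨G, A, h.symm, hGS, hGc, hGl⟩

theorem ConsecutiveBookends.hasArcPrefix [DecidableEq α] {D : List α} {S : Set α} {x y : α}
    (h : ConsecutiveBookends D S x y) (hS : S.Nontrivial) (hx : D.count x = 2)
    {P Q : List α} (hPQ : D ~r (x :: P ++ x :: Q)) :
    HasArcPrefix (S \ {x}) y P ∨ HasArcPrefix (S \ {x}) y P.reverse ∨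
      HasArcPrefix (S \ {x}) y Q ∨ HasArcPrefix (S \ {x}) y Q.reverse := by
  rcases h with h | h
  · have hxS : x ∈ S := by
      obtain ⟨F, R, -, hF, -, hx, -⟩ := h
      exact hF x (mem_of_mem_head? hx)
    have := h.hasArcPrefix hS hxS hx hPQ
    tauto
  · have hxS : x ∈ S := by
      obtain ⟨F, R, -, hF, -, -, hx⟩ := h
      exact hF x (mem_of_mem_getLast? hx)
    have hrev : D.reverse ~r (x :: P.reverse ++ x :: Q.reverse) := by
      refine hPQ.reverse.trans ?_
      simpa using isRotated_append (l := Q.reverse) (l' := x :: P.reverse ++ [x])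
    have := h.reverse.hasArcPrefix hS hxS (by simpa using hx) hrev
    tauto

theorem ConsecutiveBookends.symm [DecidableEq α] {D : List α} {S : Set α} {x y : α}
    (h : ConsecutiveBookends D S x y) : ConsecutiveBookends D S y x :=
  Or.symm h

theorem HasArcPrefix.consecutiveBookends [DecidableEq α] {T T' : Set α} {y y' : α}
    {W W' Z J : List α} (h : HasArcPrefix T y W.reverse) (h' : HasArcPrefix T' y' W')
    (hT : Disjoint T T') (hJ : J ~r (W ++ W' ++ Z)) :
    ConsecutiveBookends J (T ∪ T') y y' := by
  obtain ⟨G, R, hW, hG, hGc, hGl⟩ := h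
  obtain ⟨G', R', rfl, hG', hGc', hGl'⟩ := h'
  obtain rfl : W = R.reverse ++ G.reverse := by simpa using congrArg List.reverse hW
  refine .inl ⟨G.reverse ++ G', R' ++ Z ++ R.reverse, ?_, ?_, ?_, ?_, ?_⟩
  · refine hJ.trans ?_
    have := isRotated_append (l := R.reverse) (l' := G.reverse ++ G' ++ (R' ++ Z))
    simpa using this
  · intro v hv
    rcases mem_append.1 hv with hv | hv
    · exact .inl (hG v (mem_reverse.1 hv))
    · exact .inr (hG' v hv)
  · rintro s (hs | hs)
    · have : s ∉ G' := fun h => hT.le_bot ⟨hs, hG' s h⟩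
      simp [hGc s hs, count_eq_zero.2 this]
    · have : s ∉ G := fun h => hT.le_bot ⟨hG s h, hs⟩
      simp [hGc' s hs, count_eq_zero.2 this]
  · simp [head?_append, hGl]
  · simp [getLast?_append, hGl']

/-- Writing `D` cyclically as `x P x Q` and `D'` cyclically as `x' P' x' Q'`,
the four circle-joins `(D,x)⊙(D',x')`, `(D',x')⊙(D,x)`, `(D,x)⊙(D'ʳ,x')` and
`(D'ʳ,x')⊙(D,x)` are the cyclic words `P P' Q Q'`, `P' P Q' Q`, `P Q'ʳ Q P'ʳ`
and `Q'ʳ P P'ʳ Q`.  If `S` is consecutive in `D` with bookends `x, y` and `S'`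
is consecutive in `D'` with bookends `x', y'`, then
`X = (S \ {x}) ∪ (S' \ {x'})` is consecutive in at least one of these four
circle-joins, with bookends `y` and `y'`. -/
theorem consecutive_in_circle_join [DecidableEq α]
    (Vs Vs' : Finset α) (hdisj : Disjoint Vs Vs')
    (D D' : List α)
    (hD : IsChordDiagramOn (↑Vs) D) (hD' : IsChordDiagramOn (↑Vs') D')
    (S : Finset α) (hSsub : S ⊆ Vs) (hS1 : 1 < S.card) (hS2 : S.card < Vs.card)
    (S' : Finset α) (hS'sub : S' ⊆ Vs') (hS'1 : 1 < S'.card) (hS'2 : S'.card < Vs'.card)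
    (x y x' y' : α)
    (hS : ConsecutiveBookends D (↑S) x y)
    (hS' : ConsecutiveBookends D' (↑S') x' y')
    (P Q P' Q' : List α)
    (hPQ : D ~r ([x] ++ P ++ [x] ++ Q))
    (hP'Q' : D' ~r ([x'] ++ P' ++ [x'] ++ Q')) :
    ConsecutiveBookends (P ++ P' ++ Q ++ Q') ((↑S \ {x}) ∪ (↑S' \ {x'})) y y' ∨
    ConsecutiveBookends (P' ++ P ++ Q' ++ Q) ((↑S \ {x}) ∪ (↑S' \ {x'})) y y' ∨
    ConsecutiveBookends (P ++ Q'.reverse ++ Q ++ P'.reverse)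
      ((↑S \ {x}) ∪ (↑S' \ {x'})) y y' ∨
    ConsecutiveBookends (Q'.reverse ++ P ++ P'.reverse ++ Q)
      ((↑S \ {x}) ∪ (↑S' \ {x'})) y y' := by
  have hnt : (S : Set α).Nontrivial := Finset.one_lt_card_iff_nontrivial.1 hS1
  have hnt' : (S' : Set α).Nontrivial := Finset.one_lt_card_iff_nontrivial.1 hS'1
  have hx : D.count x = 2 := hD.1 x (hD.2 x (hPQ.mem_iff.2 (by simp)))
  have hx' : D'.count x' = 2 := hD'.1 x' (hD'.2 x' (hP'Q'.mem_iff.2 (by simp)))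
  have hT : Disjoint ((S : Set α) \ {x}) (↑S' \ {x'}) :=
    (Finset.disjoint_coe.2 (Finset.disjoint_of_subset_left hSsub
      (Finset.disjoint_of_subset_right hS'sub hdisj))).mono Set.sdiff_subset Set.sdiff_subset
  -- The arc of `S` first, or the arc of `S'` first, in a rotation of the circle-join.
  have fwd {W W' Z J : List α} (h : HasArcPrefix (↑S \ {x}) y W.reverse)
      (h' : HasArcPrefix (↑S' \ {x'}) y' W') (hJ : J ~r (W ++ W' ++ Z)) :
      ConsecutiveBookends J ((↑S \ {x}) ∪ (↑S' \ {x'})) y y' :=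
    h.consecutiveBookends h' hT hJ
  have bwd {W W' Z J : List α} (h : HasArcPrefix (↑S \ {x}) y W')
      (h' : HasArcPrefix (↑S' \ {x'}) y' W.reverse) (hJ : J ~r (W ++ W' ++ Z)) :
      ConsecutiveBookends J ((↑S \ {x}) ∪ (↑S' \ {x'})) y y' := by
    rw [Set.union_comm]
    exact (h'.consecutiveBookends h hT.symm hJ).symm
  have rot₀ (A B C E : List α) : (A ++ B ++ C ++ E) ~r (A ++ B ++ (C ++ E)) := by
    rw [append_assoc _ C]
  have rot₁ (A B C E : List α) : (A ++ B ++ C ++ E) ~r (B ++ C ++ (E ++ A)) := by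
    simpa using isRotated_append (l := A) (l' := B ++ C ++ E)
  have rot₂ (A B C E : List α) : (A ++ B ++ C ++ E) ~r (C ++ E ++ (A ++ B)) := by
    simpa using isRotated_append (l := A ++ B) (l' := C ++ E)
  have rot₃ (A B C E : List α) : (A ++ B ++ C ++ E) ~r (E ++ A ++ (B ++ C)) := by
    simpa using isRotated_append (l := A ++ B ++ C) (l' := E)
  have hrev {T : Set α} {z : α} {W : List α} (h : HasArcPrefix T z W) :
      HasArcPrefix T z W.reverse.reverse := by rwa [reverse_reverse]
  rcases hS.hasArcPrefix hnt hx (by simpa using hPQ) with h | h | h | h <;>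
    rcases hS'.hasArcPrefix hnt' hx' (by simpa using hP'Q') with h' | h' | h' | h'
  · exact .inr (.inr (.inl (bwd h (hrev h') (rot₃ ..))))
  · exact .inr (.inl (bwd h h' (rot₀ ..)))
  · exact .inr (.inr (.inr (bwd h (hrev h') (rot₀ ..))))
  · exact .inl (bwd h h' (rot₃ ..))
  · exact .inl (fwd h h' (rot₀ ..))
  · exact .inr (.inr (.inr (fwd h h' (rot₁ ..))))
  · exact .inr (.inl (fwd h h' (rot₁ ..)))
  · exact .inr (.inr (.inl (fwd h h' (rot₀ ..))))
  · exact .inr (.inr (.inr (bwd h (hrev h') (rot₂ ..))))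
  · exact .inl (bwd h h' (rot₁ ..))
  · exact .inr (.inr (.inl (bwd h (hrev h') (rot₁ ..))))
  · exact .inr (.inl (bwd h h' (rot₂ ..)))
  · exact .inr (.inl (fwd h h' (rot₃ ..)))
  · exact .inr (.inr (.inl (fwd h h' (rot₂ ..))))
  · exact .inl (fwd h h' (rot₂ ..))
  · exact .inr (.inr (.inr (fwd h h' (rot₃ ..))))
end

section
/- Let G be a connected finite graph such that every bipartition (A,B) of V(G) with |A| >= 2 and |B| >= 2 is a split of G. Then G is a complete graph or a star, i.e., a graph in which one vertex is adjacent to all other vertices and there are no other edges. -/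
open List

/-- If every bipartition into parts of size at least two is a split, then the end vertices of two
disjoint edges are adjacent. -/
theorem adj_of_disjoint_edges {V : Type*} [Finite V] {G : SimpleGraph V}
    (hdeg : ∀ A B : Set V, A ∪ B = Set.univ → Disjoint A B →
      2 ≤ A.ncard → 2 ≤ B.ncard →
      ∃ A' B' : Set V, A' ⊆ A ∧ B' ⊆ B ∧
        ∀ a ∈ A, ∀ b ∈ B, (G.Adj a b ↔ a ∈ A' ∧ b ∈ B'))
    {u x v y : V} (hux : G.Adj u x) (hvy : G.Adj v y)
    (huv : u ≠ v) (huy : u ≠ y) (hxv : x ≠ v) (hxy : x ≠ y) : G.Adj u v := by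
  have hpair : ({x, v} : Set V) ⊆ {u, y}ᶜ := by
    rintro z (rfl | rfl)
    · simp [hux.ne', hxy]
    · simp [huv.symm, hvy.ne]
  have hcard : 2 ≤ ({u, y}ᶜ : Set V).ncard :=
    (Set.ncard_pair hxv).ge.trans (Set.ncard_le_ncard hpair)
  obtain ⟨A', B', -, -, h⟩ := hdeg {u, y} {u, y}ᶜ (Set.union_compl_self _) disjoint_compl_right
    (Set.ncard_pair huy).ge hcard
  have hx := (h u (by simp) x (hpair (by simp))).1 hux
  have hv := (h y (by simp) v (hpair (by simp))).1 hvy.symm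
  exact (h u (by simp) v (hpair (by simp))).2 ⟨hx.1, hv.2⟩

/-- A connected finite graph in which every bipartition `(A, B)` of the vertex set
with `|A| ≥ 2` and `|B| ≥ 2` is a split is a complete graph or a star. -/
theorem degenerate_is_clique_or_star {V : Type*} [Fintype V]
    (G : SimpleGraph V) (hconn : G.Connected)
    (hdeg : ∀ A B : Set V, A ∪ B = Set.univ → Disjoint A B →
      2 ≤ A.ncard → 2 ≤ B.ncard →
      ∃ A' B' : Set V, A' ⊆ A ∧ B' ⊆ B ∧
        ∀ a ∈ A, ∀ b ∈ B, (G.Adj a b ↔ a ∈ A' ∧ b ∈ B')) :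
    G = ⊤ ∨ ∃ c : V, ∀ u v : V, G.Adj u v ↔ (u = c ∧ v ≠ c) ∨ (v = c ∧ u ≠ c) := by
  by_cases hcomplete : ∀ u v, u ≠ v → G.Adj u v
  · left
    ext u v
    exact ⟨fun h => h.ne, hcomplete u v⟩
  right
  push Not at hcomplete
  obtain ⟨u, v, huv, hnadj⟩ := hcomplete
  have : Nontrivial V := ⟨u, v, huv⟩
  have hnbr : ∀ w, ∃ x, G.Adj w x := hconn.preconnected.exists_adj_of_nontrivial
  have hcommon : ∀ x y, G.Adj u x → G.Adj v y → x = y := by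
    intro x y hx hy
    by_contra hxy
    refine hnadj (adj_of_disjoint_edges hdeg hx hy huv ?_ ?_ hxy)
    · rintro rfl
      exact hnadj hy.symm
    · rintro rfl
      exact hnadj hx
  obtain ⟨c, huc⟩ := hnbr u
  obtain ⟨d, hvd⟩ := hnbr v
  have hu : ∀ x, G.Adj u x → x = c := fun x hx =>
    (hcommon x d hx hvd).trans (hcommon c d huc hvd).symm
  have hedge : ∀ x y, G.Adj x y → x = c ∨ y = c := by
    intro x y hxy
    by_contra! hne
    have hux : u ≠ x := by
      rintro rfl
      exact hne.2 (hu y hxy)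
    have huy : u ≠ y := by
      rintro rfl
      exact hne.1 (hu x hxy.symm)
    exact hne.1 (hu x (adj_of_disjoint_edges hdeg huc hxy hux huy hne.1.symm hne.2.symm))
  have hc : ∀ w, w ≠ c → G.Adj w c := by
    intro w hw
    obtain ⟨x, hx⟩ := hnbr w
    exact (hedge w x hx).resolve_left hw ▸ hx
  refine ⟨c, fun x y => ⟨fun h => ?_, ?_⟩⟩
  · rcases hedge x y h with rfl | rfl
    · exact Or.inl ⟨rfl, h.ne'⟩
    · exact Or.inr ⟨rfl, h.ne⟩
  · rintro (⟨rfl, h⟩ | ⟨rfl, h⟩)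
    · exact (hc y h).symm
    · exact hc x h
end

section
/- Let σ be a LexBFS ordering of a graph G and let y be a vertex of G. Then the restriction of σ to the slice S(y) is a LexBFS ordering of the induced subgraph G[S(y)]. -/
open List

variable {α : Type*}

/-- In a LexBFS ordering `A ++ L ++ B`, if every vertex of `A` sees either all or none of `L`,
then `L` is a LexBFS ordering of the subgraph induced by its vertices. -/
theorem IsLexBFSOrder.of_uniform_prefix {V : Type*} {G : SimpleGraph V} {A L B : List V}
    (hσ : IsLexBFSOrder G (A ++ L ++ B))
    (hu : ∀ x ∈ A, ∀ z ∈ L, ∀ w ∈ L, G.Adj x z → G.Adj x w) :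
    IsLexBFSOrderOn G {v | v ∈ L} L := by
  obtain ⟨hnd, -, hlex⟩ := hσ
  refine ⟨(List.nodup_append.1 (List.nodup_append.1 hnd).1).2.1, fun v => Iff.rfl, ?_⟩
  have hlen : (A ++ L ++ B).length = A.length + L.length + B.length := by simp [Nat.add_assoc]
  have hget : ∀ (i : ℕ) (hi : i < L.length) (hi' : A.length + i < (A ++ L ++ B).length),
      (A ++ L ++ B).get ⟨A.length + i, hi'⟩ = L.get ⟨i, hi⟩ := by
    intro i hi hi'
    simp [hi]
  rintro ⟨i, hi⟩ ⟨j, hj⟩ ⟨k, hk⟩ hij hjk hik hnij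
  simp only [Fin.mk_lt_mk] at hij hjk
  obtain ⟨⟨h, hh⟩, hlt, hadj, hnadj⟩ := hlex
    ⟨A.length + i, by omega⟩ ⟨A.length + j, by omega⟩ ⟨A.length + k, by omega⟩
    (by simpa using hij) (by simpa using hjk)
    (by rwa [hget i hi, hget k hk]) (by rwa [hget i hi, hget j hj])
  rw [hget j hj] at hadj
  rw [hget k hk] at hnadj
  simp only [Fin.mk_lt_mk] at hlt
  rcases lt_or_ge h A.length with hA | hA
  · refine absurd (hu _ ?_ _ (List.get_mem _ _) _ (List.get_mem _ _) hadj) hnadj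
    simp [hA]
  · obtain ⟨d, rfl⟩ := Nat.exists_eq_add_of_le hA
    have hd : d < L.length := by omega
    rw [hget d hd] at hadj hnadj
    exact ⟨⟨d, hd⟩, by simpa using hlt, hadj, hnadj⟩

/-- In a LexBFS ordering `A ++ y :: C`, if every vertex of `A` adjacent to `y` is adjacent to
`z ∈ C`, then every vertex of `A` adjacent to `z` is adjacent to `y`. -/
theorem IsLexBFSOrder.adj_of_adj_later {V : Type*} {G : SimpleGraph V} {A C : List V} {x y z : V}
    (hσ : IsLexBFSOrder G (A ++ y :: C)) (hz : z ∈ C)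
    (hyz : ∀ x ∈ A, G.Adj x y → G.Adj x z) (hx : x ∈ A) (hxz : G.Adj x z) : G.Adj x y := by
  by_contra hxy
  obtain ⟨i, hi, rfl⟩ := List.mem_iff_getElem.1 hx
  obtain ⟨k, hk, rfl⟩ := List.mem_iff_getElem.1 hz
  have hlen : (A ++ y :: C).length = A.length + (C.length + 1) := by simp
  have hgA : ∀ (i : ℕ) (hi : i < A.length) (hi' : i < (A ++ y :: C).length),
      (A ++ y :: C).get ⟨i, hi'⟩ = A[i] := by
    intro i hi hi'
    simp [hi]
  have hgy : ∀ hi' : A.length < (A ++ y :: C).length,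
      (A ++ y :: C).get ⟨A.length, hi'⟩ = y := by
    intro hi'
    simp
  have hgC : ∀ hi' : A.length + (k + 1) < (A ++ y :: C).length,
      (A ++ y :: C).get ⟨A.length + (k + 1), hi'⟩ = C[k] := by
    intro hi'
    simp
  obtain ⟨⟨h, hh⟩, hlt, hadj, hnadj⟩ := hσ.2.2
    ⟨i, by omega⟩ ⟨A.length, by omega⟩ ⟨A.length + (k + 1), by omega⟩
    (by simpa using hi) (by simp)
    (by rwa [hgA i hi, hgC]) (by rwa [hgA i hi, hgy])
  simp only [Fin.mk_lt_mk] at hlt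
  have hA : h < A.length := by omega
  rw [hgA h hA, hgy] at hadj
  rw [hgA h hA, hgC] at hnadj
  exact hnadj (hyz _ (List.getElem_mem hA) hadj)

/-- Let `σ = σ₁ ++ y :: σ₂` be a LexBFS ordering of `G` and let `y :: σ₂.take m` be
the slice `S(y)`: the largest factor of `σ` beginning at `y` such that every vertex
`x` occurring before `y` is adjacent to `y` iff `x` is adjacent to every vertex of
the factor.  Then the restriction of `σ` to `S(y)`, which is the factor
`y :: σ₂.take m` itself, is a LexBFS ordering of the induced subgraph `G[S(y)]`. -/
theorem slice_restriction_is_lexbfs {V : Type*} [Fintype V]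
    (G : SimpleGraph V) (σ σ₁ σ₂ : List V) (y : V)
    (hσ : IsLexBFSOrder G σ)
    (hdecomp : σ = σ₁ ++ y :: σ₂)
    (m : ℕ) (hmlen : m ≤ σ₂.length)
    (hm : ∀ x ∈ σ₁, (G.Adj x y ↔ ∀ z ∈ y :: σ₂.take m, G.Adj x z))
    (hmax : ∀ m' ≤ σ₂.length,
      (∀ x ∈ σ₁, (G.Adj x y ↔ ∀ z ∈ y :: σ₂.take m', G.Adj x z)) → m' ≤ m) :
    IsLexBFSOrderOn G {v | v ∈ y :: σ₂.take m} (y :: σ₂.take m) := by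
  subst hdecomp
  have hback : ∀ x ∈ σ₁, ∀ z ∈ y :: σ₂.take m, G.Adj x z → G.Adj x y := by
    intro x hx z hz hxz
    rcases List.mem_cons.1 hz with rfl | hz'
    · exact hxz
    · exact hσ.adj_of_adj_later (List.mem_of_mem_take hz')
        (fun w hw hwy => (hm w hw).1 hwy z hz) hx hxz
  refine IsLexBFSOrder.of_uniform_prefix (A := σ₁) (B := σ₂.drop m) ?_
    fun x hx z hz w hw hxz => (hm x hx).1 (hback x hx z hz hxz) w hw
  simpa using hσ
end
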